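/- arXiv:1409.1296 — 3 statements merged into one kernel-verified Lean document; each statement's English description precedes it below -/
import Mathlib

section
/- For all unit quaternions z and w, the ℝ-linear endomorphism of ℍ given by x ↦ z * x * w has determinant 1. In other words, as a linear isometry of the 4-dimensional real inner product space ℍ, left-right multiplication by unit quaternions is orientation preserving, so the map (z, w) ↦ (x ↦ z x w) lands in SO(4). -/
open QuaternionAlgebra in
/-- The determinant of left multiplication on the quaternions over a commutative ring. -/
theorem QuaternionAlgebra.det_mulLeft {R : Type*} [CommRing R]
    (a : QuaternionAlgebra R (-1) 0 (-1)) :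
    LinearMap.det (LinearMap.mulLeft R a) =
      (a.re ^ 2 + a.imI ^ 2 + a.imJ ^ 2 + a.imK ^ 2) ^ 2 := by
  have h : LinearMap.toMatrix (basisOneIJK (-1 : R) 0 (-1)) (basisOneIJK (-1 : R) 0 (-1))
      (LinearMap.mulLeft R a) =
      !![a.re, -a.imI, -a.imJ, -a.imK; a.imI, a.re, -a.imK, a.imJ;
        a.imJ, a.imK, a.re, -a.imI; a.imK, -a.imJ, a.imI, a.re] := by
    ext i j
    rw [LinearMap.toMatrix_apply, LinearMap.mulLeft_apply, coe_basisOneIJK_repr]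
    fin_cases i <;> fin_cases j <;>
      simp [basisOneIJK, Module.Basis.ofEquivFun, equivTuple]
  rw [← LinearMap.det_toMatrix (basisOneIJK (-1 : R) 0 (-1)), h]
  simp [Matrix.det_succ_row_zero, Fin.sum_univ_succ, Fin.succAbove]
  ring

/-- Left multiplication by a unit quaternion has determinant one. -/
theorem Quaternion.det_mulLeft_of_norm_eq_one (q : Quaternion ℝ) (hq : ‖q‖ = 1) :
    LinearMap.det (LinearMap.mulLeft ℝ q) = 1 := by
  have h : q.re ^ 2 + q.imI ^ 2 + q.imJ ^ 2 + q.imK ^ 2 = 1 := by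
    rw [← Quaternion.normSq_def', Quaternion.normSq_eq_norm_mul_self, hq, one_mul]
  refine (QuaternionAlgebra.det_mulLeft q).trans ?_
  rw [h, one_pow]

open QuaternionAlgebra in
/-- The determinant of right multiplication on the quaternions over a commutative ring. -/
theorem QuaternionAlgebra.det_mulRight {R : Type*} [CommRing R]
    (a : QuaternionAlgebra R (-1) 0 (-1)) :
    LinearMap.det (LinearMap.mulRight R a) =
      (a.re ^ 2 + a.imI ^ 2 + a.imJ ^ 2 + a.imK ^ 2) ^ 2 := by
  have h : LinearMap.toMatrix (basisOneIJK (-1 : R) 0 (-1)) (basisOneIJK (-1 : R) 0 (-1))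
      (LinearMap.mulRight R a) =
      !![a.re, -a.imI, -a.imJ, -a.imK; a.imI, a.re, a.imK, -a.imJ;
        a.imJ, -a.imK, a.re, a.imI; a.imK, a.imJ, -a.imI, a.re] := by
    ext i j
    rw [LinearMap.toMatrix_apply, LinearMap.mulRight_apply, coe_basisOneIJK_repr]
    fin_cases i <;> fin_cases j <;>
      simp [basisOneIJK, Module.Basis.ofEquivFun, equivTuple]
  rw [← LinearMap.det_toMatrix (basisOneIJK (-1 : R) 0 (-1)), h]
  simp [Matrix.det_succ_row_zero, Fin.sum_univ_succ, Fin.succAbove]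
  ring

/-- Right multiplication by a unit quaternion has determinant one. -/
theorem Quaternion.det_mulRight_of_norm_eq_one (q : Quaternion ℝ) (hq : ‖q‖ = 1) :
    LinearMap.det (LinearMap.mulRight ℝ q) = 1 := by
  have h : q.re ^ 2 + q.imI ^ 2 + q.imJ ^ 2 + q.imK ^ 2 = 1 := by
    rw [← Quaternion.normSq_def', Quaternion.normSq_eq_norm_mul_self, hq, one_mul]
  refine (QuaternionAlgebra.det_mulRight q).trans ?_
  rw [h, one_pow]


/-- For unit quaternions `z, w`, the ℝ-linear endomorphism of `ℍ` given by
`x ↦ z * x * w` has determinant `1`, i.e. it is an orientation-preserving isometry,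
an element of `SO(4)`. -/
theorem det_unit_quaternion_mul_left_right (z w : Quaternion ℝ)
    (hz : ‖z‖ = 1) (hw : ‖w‖ = 1) :
    LinearMap.det ((LinearMap.mulLeft ℝ z).comp (LinearMap.mulRight ℝ w)) = 1 := by
  rw [LinearMap.det_comp, Quaternion.det_mulLeft_of_norm_eq_one z hz,
    Quaternion.det_mulRight_of_norm_eq_one w hw, one_mul]
end

section
/- The morphism Sp(1) × Sp(1) → SO(4) is surjective: every ℝ-linear isometric equivalence f of ℍ whose determinant (as an ℝ-linear endomorphism of the 4-dimensional real vector space ℍ) equals 1 is of the form f(x) = z * x * w for some unit quaternions z and w. -/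
open scoped Quaternion

/-- The reflection in the hyperplane orthogonal to a unit quaternion `u` is
`x ↦ -u * star x * u`. -/
theorem Quaternion.reflection_orthogonal_singleton {u : ℍ[ℝ]} (hu : ‖u‖ = 1) (x : ℍ[ℝ]) :
    (ℝ ∙ u)ᗮ.reflection x = -u * star x * u := by
  have hsu : star u * u = 1 := by
    rw [Quaternion.star_mul_self, Quaternion.normSq_eq_norm_mul_self, hu]
    simp
  have hadd : u * star x + x * star u = ((2 * (u * star x).re : ℝ) : ℍ[ℝ]) := by
    simpa using Quaternion.self_add_star' (u * star x)
  have hx : x = x * star u * u := by rw [mul_assoc, hsu, mul_one]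
  rw [Submodule.reflection_orthogonal_apply, Submodule.reflection_singleton_apply, hu,
    Quaternion.inner_def]
  have hsmul : (2 : ℕ) • ((u * star x).re / (1 : ℝ) ^ 2) • u
      = (u * star x + x * star u) * u := by
    rw [hadd, Quaternion.coe_mul_eq_smul, ← Nat.cast_smul_eq_nsmul ℝ, smul_smul]
    norm_num
  have hgoal : -((u * star x + x * star u) * u - x) = -u * star x * u := by
    rw [add_mul, ← hx]
    simp
  rw [← hgoal, ← hsmul]
  simp

/-- A product of hyperplane reflections of `ℍ` is `x ↦ z * x * w` or `x ↦ z * star x * w`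
according to its determinant. -/
theorem Quaternion.exists_eq_mul_mul_of_prod_reflections (l : List ℍ[ℝ]) :
    ∃ z w : ℍ[ℝ], ‖z‖ = 1 ∧ ‖w‖ = 1 ∧
      ((LinearMap.det
          (l.map fun v => (ℝ ∙ v)ᗮ.reflection).prod.toLinearEquiv.toLinearMap = 1 ∧
        ∀ x, (l.map fun v => (ℝ ∙ v)ᗮ.reflection).prod x = z * x * w) ∨
      (LinearMap.det
          (l.map fun v => (ℝ ∙ v)ᗮ.reflection).prod.toLinearEquiv.toLinearMap = -1 ∧
        ∀ x, (l.map fun v => (ℝ ∙ v)ᗮ.reflection).prod x = z * star x * w)) := by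
  induction l with
  | nil => exact ⟨1, 1, norm_one, norm_one, .inl ⟨LinearMap.det_id, fun x => by simp⟩⟩
  | cons v l ih =>
    obtain ⟨z, w, hz, hw, h⟩ := ih
    rw [List.map_cons, List.prod_cons]
    generalize (l.map fun v => (ℝ ∙ v)ᗮ.reflection).prod = g at h ⊢
    by_cases hv : v = 0
    · have hone : (ℝ ∙ v)ᗮ.reflection = 1 := by
        ext1 x
        exact Submodule.reflection_mem_subspace_eq_self (by simp [hv])
      rw [hone, one_mul]
      exact ⟨z, w, hz, hw, h⟩
    have hdet : LinearMap.det ((ℝ ∙ v)ᗮ.reflection * g).toLinearEquiv.toLinearMap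
        = -LinearMap.det g.toLinearEquiv.toLinearMap := by
      have hmul : ((ℝ ∙ v)ᗮ.reflection * g).toLinearEquiv.toLinearMap
          = (ℝ ∙ v)ᗮ.reflection.toLinearEquiv.toLinearMap * g.toLinearEquiv.toLinearMap := rfl
      have hrefl : LinearMap.det (ℝ ∙ v)ᗮ.reflection.toLinearEquiv.toLinearMap = -1 := by
        have := (ℝ ∙ v)ᗮ.det_reflection
        rwa [Submodule.orthogonal_orthogonal, finrank_span_singleton hv, pow_one] at this
      rw [hmul, map_mul, hrefl, neg_one_mul]
    obtain ⟨u, hu, huv⟩ : ∃ u : ℍ[ℝ], ‖u‖ = 1 ∧ (ℝ ∙ u) = ℝ ∙ v :=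
      ⟨‖v‖⁻¹ • v, norm_smul_inv_norm hv, Submodule.span_singleton_smul_eq
        (IsUnit.mk0 _ (inv_ne_zero (norm_ne_zero_iff.2 hv))) v⟩
    have hrefl (y : ℍ[ℝ]) : (ℝ ∙ v)ᗮ.reflection y = -u * star y * u := by
      rw [← Quaternion.reflection_orthogonal_singleton hu y]
      simp only [huv]
    refine ⟨-u * star w, star z * u, by simp [hu, hw], by simp [hu, hz], ?_⟩
    rw [hdet]
    rcases h with ⟨hg, h⟩ | ⟨hg, h⟩
    · exact .inr ⟨by rw [hg], fun x => by simp [hrefl, h, mul_assoc]⟩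
    · exact .inl ⟨by rw [hg, neg_neg], fun x => by simp [hrefl, h, mul_assoc]⟩

/-- The morphism `Sp(1) × Sp(1) → SO(4)` is surjective: every ℝ-linear isometric
equivalence `f` of `ℍ` with determinant `1` is of the form `f x = z * x * w` for some
unit quaternions `z` and `w`. -/
theorem sp1_times_sp1_to_so4_surjective (f : Quaternion ℝ ≃ₗᵢ[ℝ] Quaternion ℝ)
    (hf : LinearMap.det f.toLinearEquiv.toLinearMap = 1) :
    ∃ z w : Quaternion ℝ, ‖z‖ = 1 ∧ ‖w‖ = 1 ∧ ∀ x : Quaternion ℝ, f x = z * x * w := by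
  obtain ⟨l, -, hl⟩ := f.reflections_generate_dim
  obtain ⟨z, w, hz, hw, ⟨-, h⟩ | ⟨hdet, -⟩⟩ :=
    Quaternion.exists_eq_mul_mul_of_prod_reflections l
  · exact ⟨z, w, hz, hw, fun x => by rw [hl, h]⟩
  · rw [← hl, hf] at hdet
    norm_num at hdet
end

section
/- The second homotopy group of SO(4) is trivial: π₂(SO(4), 1) ≅ 0, where SO(4) is the topological group of real 4×4 matrices A satisfying Aᵀ * A = 1 and det A = 1, with the subspace topology from the space of 4×4 real matrices and basepoint the identity matrix. -/
open Topology Matrix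

/-- `SO(4)` as the space of real 4×4 matrices `A` with `Aᵀ * A = 1` and `det A = 1`,
with the subspace topology induced from the space of 4×4 real matrices. -/
abbrev SO4 : Type := {A : Matrix (Fin 4) (Fin 4) ℝ // Aᵀ * A = 1 ∧ A.det = 1}

/-- The identity matrix, as the basepoint of `SO(4)`. -/
def so4One : SO4 := ⟨1, by simp⟩

open scoped unitInterval Topology.Homotopy Manifold ContDiff Quaternion

/-- A generalized loop lifts through a covering map to a generalized loop, as soon as the cube has
dimension at least two. -/
theorem IsCoveringMap.exists_genLoop_lift {E X N : Type*} [TopologicalSpace E] [TopologicalSpace X]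
    [DecidableEq N] [Nontrivial N] {p : E → X} (cov : IsCoveringMap p) {e : E} {x : X}
    (he : p e = x) (f : Ω^ N X x) : ∃ F : Ω^ N E e, ∀ y, p (F y) = f y := by
  obtain ⟨i, k, hik⟩ := exists_pair_ne N
  let H : C(I × (I^{j // j ≠ i}), X) := f.1.comp (Cube.insertAt i)
  have H_boundary (t : I) (a : I^{j // j ≠ i})
      (h : (t = 0 ∨ t = 1) ∨ a ∈ Cube.boundary {j // j ≠ i}) : H (t, a) = x :=
    f.2 _ (Cube.insertAt_boundary i h)
  let G : C(I × (I^{j // j ≠ i}), E) := cov.liftHomotopy H (.const _ e)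
    fun a ↦ (H_boundary 0 a (.inl (.inl rfl))).trans he.symm
  have pG (ta) : p (G ta) = H ta := congr_fun (cov.liftHomotopy_lifts H _ _) ta
  have G_zero (a) : G (0, a) = e := cov.liftHomotopy_zero H _ _ a
  have G_side (t : I) (a) (ha : a ∈ Cube.boundary {j // j ≠ i}) : G (t, a) = e := by
    rw [← G_zero a]
    refine cov.const_of_comp (g := fun s ↦ G (s, a)) (by fun_prop) (fun s s' ↦ ?_) t 0
    rw [pG, pG, H_boundary s a (.inr ha), H_boundary s' a (.inr ha)]
  have G_one (a) : G (1, a) = e := by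
    rw [← G_side 1 (fun _ ↦ 0) ⟨⟨k, hik.symm⟩, .inl rfl⟩]
    refine cov.const_of_comp (g := fun a ↦ G (1, a)) (by fun_prop) (fun a a' ↦ ?_) a _
    rw [pG, pG, H_boundary 1 a (.inl (.inr rfl)), H_boundary 1 a' (.inl (.inr rfl))]
  refine ⟨⟨G.comp (Cube.splitAt i), ?_⟩, fun y ↦ ?_⟩
  · rintro y ⟨j, hj⟩
    change G (y i, fun j : {j // j ≠ i} ↦ y j) = e
    by_cases hji : j = i
    · subst hji
      obtain hj | hj := hj <;> rw [hj]
      exacts [G_zero _, G_one _]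
    · exact G_side _ _ ⟨⟨j, hji⟩, hj⟩
  · change p (G (Cube.splitAt i y)) = f y
    rw [pG]
    exact congrArg f ((Cube.splitAt i).symm_apply_apply y)

/-- A higher homotopy group of the base of a covering map is trivial if that of the total space
is. -/
theorem IsCoveringMap.subsingleton_homotopyGroup {E X N : Type*} [TopologicalSpace E]
    [TopologicalSpace X] [DecidableEq N] [Nontrivial N] {p : E → X} (cov : IsCoveringMap p)
    {e : E} {x : X} (he : p e = x) [Subsingleton (HomotopyGroup N E e)] :
    Subsingleton (HomotopyGroup N X x) := by
  refine ⟨fun a b ↦ ?_⟩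
  induction a, b using Quotient.inductionOn₂ with | _ f g
  obtain ⟨F, hF⟩ := cov.exists_genLoop_lift he f
  obtain ⟨G, hG⟩ := cov.exists_genLoop_lift he g
  have h : GenLoop.Homotopic F G :=
    Quotient.exact (Subsingleton.elim (α := HomotopyGroup N E e) ⟦F⟧ ⟦G⟧)
  have h' := ContinuousMap.HomotopicRel.comp_continuousMap h ⟨p, cov.continuous⟩
  refine Quotient.sound (?_ : f.1.HomotopicRel g.1 _)
  convert h'
  · exact ContinuousMap.ext fun y ↦ (hF y).symm
  · exact ContinuousMap.ext fun y ↦ (hG y).symm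

theorem HomotopyGroup.subsingleton_prod {N X Y : Type*} [TopologicalSpace X] [TopologicalSpace Y]
    (x : X) (y : Y) [Subsingleton (HomotopyGroup N X x)] [Subsingleton (HomotopyGroup N Y y)] :
    Subsingleton (HomotopyGroup N (X × Y) (x, y)) := by
  refine ⟨fun a b ↦ ?_⟩
  induction a, b using Quotient.inductionOn₂ with | _ f g
  let fst (f : Ω^ N (X × Y) (x, y)) : Ω^ N X x :=
    ⟨ContinuousMap.fst.comp f.1, fun t ht ↦ congrArg Prod.fst (f.2 t ht)⟩
  let snd (f : Ω^ N (X × Y) (x, y)) : Ω^ N Y y :=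
    ⟨ContinuousMap.snd.comp f.1, fun t ht ↦ congrArg Prod.snd (f.2 t ht)⟩
  obtain ⟨H⟩ : GenLoop.Homotopic (fst f) (fst g) :=
    Quotient.exact (Subsingleton.elim (α := HomotopyGroup N X x) ⟦_⟧ ⟦_⟧)
  obtain ⟨K⟩ : GenLoop.Homotopic (snd f) (snd g) :=
    Quotient.exact (Subsingleton.elim (α := HomotopyGroup N Y y) ⟦_⟧ ⟦_⟧)
  exact Quotient.sound ⟨H.prod K⟩

/-- A generalized loop which stays in a chart onto the whole of a vector space is null-homotopic. -/
theorem GenLoop.homotopic_const_of_forall_mem_source {N X V : Type*} [TopologicalSpace X]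
    [AddCommGroup V] [Module ℝ V] [TopologicalSpace V] [ContinuousAdd V] [ContinuousSMul ℝ V]
    {x : X} (φ : OpenPartialHomeomorph X V) (hφ : φ.target = Set.univ) (hx : x ∈ φ.source)
    (f : Ω^ N X x) (hf : ∀ y, f y ∈ φ.source) : GenLoop.Homotopic f GenLoop.const := by
  have hsymm : Continuous φ.symm := by
    simpa [hφ, continuousOn_univ] using φ.continuousOn_symm
  have hφf : Continuous fun y ↦ φ (f y) := φ.continuousOn.comp_continuous f.1.continuous hf
  refine ⟨⟨⟨⟨fun ty ↦ φ.symm ((1 - (ty.1 : ℝ)) • φ (f ty.2) + (ty.1 : ℝ) • φ x), ?_⟩, fun y ↦ ?_,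
    fun y ↦ ?_⟩, fun t y hy ↦ ?_⟩⟩
  · exact hsymm.comp <| .add (.smul (by fun_prop) (hφf.comp continuous_snd)) (by fun_prop)
  · simpa using! φ.left_inv (hf y)
  · simpa using! φ.left_inv hx
  · change φ.symm ((1 - (t : ℝ)) • φ (f y) + (t : ℝ) • φ x) = f y
    rw [GenLoop.boundary f y hy, ← add_smul, sub_add_cancel, one_smul, φ.left_inv hx]

/-- A generalized loop of dimension `n` in a vector space can be approximated by
a smooth map on `ℝⁿ` that has the same values on the boundary of the cube. -/
theorem GenLoop.exists_contDiff_approx {N F : Type*} [Fintype N] [NormedAddCommGroup F]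
    [NormedSpace ℝ F] {b : F} (f : Ω^ N F b) {ε : ℝ} (hε : 0 < ε) :
    ∃ g : (N → ℝ) → F, ContDiff ℝ ∞ g ∧ (∀ y : I^N, ‖g (fun i ↦ y i) - f y‖ < ε) ∧
      ∀ y ∈ Cube.boundary N, g (fun i ↦ y i) = b := by
  let e (x : N → ℝ) : F := f fun i ↦ Set.projIcc 0 1 zero_le_one (x i)
  have e_cont : Continuous e := f.1.continuous.comp <| by fun_prop
  have e_coe (y : I^N) : e (fun i ↦ y i) = f y := by simp [e]
  let U : Set (N → ℝ) := Set.univ.pi fun _ ↦ Set.Ioo 0 1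
  have U_open : IsOpen U := isOpen_set_pi Set.finite_univ fun _ _ ↦ isOpen_Ioo
  have e_outside (x) (hx : x ∉ U) : e x = b := by
    obtain ⟨i, hi⟩ : ∃ i, 0 < x i → 1 ≤ x i := by simpa [U] using hx
    refine f.2 _ ⟨i, ?_⟩
    by_cases h : 0 < x i
    · exact .inr (Set.projIcc_of_right_le _ (hi h))
    · exact .inl (Set.projIcc_of_le_left _ (not_lt.1 h))
  obtain ⟨g, hg⟩ := exists_contMDiffMap_forall_mem_convex_of_local_const (n := ⊤)
    𝓘(ℝ, N → ℝ) (F := F) (t := fun x ↦ Metric.ball (e x) ε ∩ {y | x ∉ U → y = b})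
    (fun x ↦ (convex_ball _ _).inter (by
      by_cases hx : x ∈ U
      · simp [hx, convex_univ]
      · simp [hx]))
    (fun x ↦ by
      by_cases hx : x ∈ U
      · refine ⟨e x, ?_⟩
        filter_upwards [U_open.mem_nhds hx, e_cont.continuousAt (Metric.ball_mem_nhds (e x) hε)]
          with y hy hy'
        exact ⟨by simpa [dist_comm] using hy', fun h ↦ absurd hy h⟩
      · refine ⟨b, ?_⟩
        filter_upwards [e_cont.continuousAt (Metric.ball_mem_nhds (e x) hε)] with y hy
        rw [e_outside x hx] at hy
        exact ⟨by simpa [dist_comm] using hy, fun _ ↦ rfl⟩)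
  refine ⟨g, g.contMDiff.contDiff, fun y ↦ ?_, ?_⟩
  · simpa [e_coe, dist_eq_norm] using (hg fun i ↦ y i).1
  · rintro y ⟨i, hi⟩
    refine (hg fun i ↦ y i).2 fun hU ↦ ?_
    have := hU i trivial
    obtain hi | hi := hi <;> simp [hi] at this

/-- A generalized loop of dimension `n` in the unit sphere of a space of dimension greater
than `n + 1` is homotopic to one that is not surjective. -/
theorem GenLoop.exists_homotopic_forall_ne {N E : Type*} [Fintype N] [NormedAddCommGroup E]
    [InnerProductSpace ℝ E] [FiniteDimensional ℝ E]
    (hN : Fintype.card N + 1 < Module.finrank ℝ E) {b : Metric.sphere (0 : E) 1}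
    (f : Ω^ N (Metric.sphere (0 : E) 1) b) :
    ∃ g : Ω^ N (Metric.sphere (0 : E) 1) b, GenLoop.Homotopic f g ∧
      ∃ v : Metric.sphere (0 : E) 1, ∀ y, g y ≠ v := by
  let f' : Ω^ N E (b : E) :=
    ⟨⟨fun y ↦ f y, by fun_prop⟩, fun y hy ↦ congrArg Subtype.val (f.2 y hy)⟩
  obtain ⟨g, g_smooth, g_approx, g_boundary⟩ := GenLoop.exists_contDiff_approx f' one_pos
  let c (t : I) (y : I^N) : E := (1 - (t : ℝ)) • (f y : E) + (t : ℝ) • g fun i ↦ y i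
  have c_ne (t y) : c t y ≠ 0 := by
    intro h
    have h1 : (f y : E) = -((t : ℝ) • (g (fun i ↦ y i) - f y)) := by
      refine eq_neg_of_add_eq_zero_left (Eq.trans ?_ h)
      simp only [c]
      module
    have h2 : ‖(f y : E)‖ < 1 := by
      rw [h1, norm_neg, norm_smul, Real.norm_of_nonneg t.2.1]
      exact (mul_le_of_le_one_left (norm_nonneg _) t.2.2).trans_lt (g_approx y)
    simp at h2
  have c_cont : Continuous fun ty : I × (I^N) ↦ c ty.1 ty.2 := by
    have := g_smooth.continuous
    fun_prop
  have c_boundary (t y) (hy : y ∈ Cube.boundary N) : c t y = b := by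
    simp only [c, g_boundary y hy, GenLoop.boundary f y hy]; module
  have c_mem (ty : I × (I^N)) : ‖c ty.1 ty.2‖⁻¹ • c ty.1 ty.2 ∈ Metric.sphere (0 : E) 1 := by
    simp [norm_smul, c_ne]
  have c_cont' : Continuous fun ty : I × (I^N) ↦ ‖c ty.1 ty.2‖⁻¹ • c ty.1 ty.2 :=
    (c_cont.norm.inv₀ fun _ ↦ norm_ne_zero_iff.2 (c_ne _ _)).smul c_cont
  let H : C(I × (I^N), Metric.sphere (0 : E) 1) :=
    ⟨fun ty ↦ ⟨_, c_mem ty⟩, c_cont'.subtype_mk c_mem⟩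
  have H_boundary (t y) (hy : y ∈ Cube.boundary N) : H (t, y) = b :=
    Subtype.ext <| by simp [H, c_boundary t y hy]
  let k : Ω^ N (Metric.sphere (0 : E) 1) b :=
    ⟨H.comp (.prodMk (.const _ 1) (.id _)), fun y hy ↦ H_boundary 1 y hy⟩
  have cone_smooth : ContDiff ℝ 1 fun z : (N → ℝ) × ℝ ↦ z.2 • g z.1 :=
    contDiff_snd.smul ((g_smooth.of_le (by simp)).comp contDiff_fst)
  obtain ⟨v, hv⟩ := (cone_smooth.dense_compl_range_of_finrank_lt_finrank (by simpa)).nonempty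
  have v_ne : v ≠ 0 := fun h ↦ hv ⟨(0, 0), by simp [h]⟩
  refine ⟨k, ⟨⟨H, fun y ↦ ?_, fun y ↦ rfl⟩, fun t y hy ↦ ?_⟩,
    ⟨‖v‖⁻¹ • v, by simp [norm_smul, v_ne]⟩, fun y hy ↦ hv ?_⟩
  · exact Subtype.ext <| by simp [H, c]
  · exact (H_boundary t y hy).trans (GenLoop.boundary f y hy).symm
  · refine ⟨(fun i ↦ y i, ‖v‖ * ‖c 1 y‖⁻¹), ?_⟩
    have hy' : ‖c 1 y‖⁻¹ • c 1 y = ‖v‖⁻¹ • v := congrArg Subtype.val hy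
    have hc : c 1 y = g fun i ↦ y i := by simp [c]
    change (‖v‖ * ‖c 1 y‖⁻¹) • (g fun i ↦ y i) = v
    rw [← hc, mul_smul, hy', smul_inv_smul₀ (norm_ne_zero_iff.2 v_ne)]

/-- The homotopy group in dimension `n` of the unit sphere of a space of dimension greater than
`n + 1` is trivial. -/
theorem HomotopyGroup.subsingleton_sphere {N E : Type*} [Fintype N] [Nonempty N]
    [NormedAddCommGroup E] [InnerProductSpace ℝ E] [FiniteDimensional ℝ E]
    (hN : Fintype.card N + 1 < Module.finrank ℝ E) (b : Metric.sphere (0 : E) 1) :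
    Subsingleton (HomotopyGroup N (Metric.sphere (0 : E) 1) b) := by
  suffices h : ∀ f : Ω^ N (Metric.sphere (0 : E) 1) b, GenLoop.Homotopic f GenLoop.const by
    refine ⟨fun a c ↦ ?_⟩
    induction a, c using Quotient.inductionOn₂ with | _ f g
    exact Quotient.sound ((h f).trans (h g).symm)
  intro f
  obtain ⟨g, hfg, v, hv⟩ := GenLoop.exists_homotopic_forall_ne hN f
  have hb : b ≠ v := by
    rw [← GenLoop.boundary g (fun _ ↦ 0) ⟨Classical.arbitrary N, .inl rfl⟩]
    exact hv _
  exact hfg.trans <| GenLoop.homotopic_const_of_forall_mem_source (f := g)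
    (stereographic (norm_eq_of_mem_sphere v)) rfl hb hv

namespace Quaternion

/-- The imaginary unit `i`. -/
@[simps] def unitI : ℍ[ℝ] := ⟨0, 1, 0, 0⟩

/-- The imaginary unit `j`. -/
@[simps] def unitJ : ℍ[ℝ] := ⟨0, 0, 1, 0⟩

/-- The imaginary unit `k`. -/
@[simps] def unitK : ℍ[ℝ] := ⟨0, 0, 0, 1⟩

/-- The coordinates of a quaternion in the basis `1, i, j, k`. -/
def toVec (q : ℍ[ℝ]) : Fin 4 → ℝ := ![q.re, q.imI, q.imJ, q.imK]

/-- The matrix of left multiplication by a quaternion in the basis `1, i, j, k`. -/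
def leftMatrix (q : ℍ[ℝ]) : Matrix (Fin 4) (Fin 4) ℝ :=
  !![q.re, -q.imI, -q.imJ, -q.imK;
     q.imI, q.re, -q.imK, q.imJ;
     q.imJ, q.imK, q.re, -q.imI;
     q.imK, -q.imJ, q.imI, q.re]

/-- The matrix of right multiplication by a quaternion in the basis `1, i, j, k`. -/
def rightMatrix (q : ℍ[ℝ]) : Matrix (Fin 4) (Fin 4) ℝ :=
  !![q.re, -q.imI, -q.imJ, -q.imK;
     q.imI, q.re, q.imK, -q.imJ;
     q.imJ, -q.imK, q.re, q.imI;
     q.imK, q.imJ, -q.imI, q.re]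

theorem toVec_surjective : Function.Surjective toVec := fun v ↦
  ⟨⟨v 0, v 1, v 2, v 3⟩, by ext i; fin_cases i <;> rfl⟩

theorem toVec_injective : Function.Injective toVec := fun _ _ h ↦
  Quaternion.ext _ _ (congr_fun h 0) (congr_fun h 1) (congr_fun h 2) (congr_fun h 3)

theorem toVec_dotProduct (p q : ℍ[ℝ]) :
    toVec p ⬝ᵥ toVec q = p.re * q.re + p.imI * q.imI + p.imJ * q.imJ + p.imK * q.imK := by
  simp [toVec, dotProduct, Fin.sum_univ_four]

theorem toVec_dotProduct_self (q : ℍ[ℝ]) : toVec q ⬝ᵥ toVec q = normSq q := by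
  rw [toVec_dotProduct, normSq_def']; ring

theorem leftMatrix_mulVec (p q : ℍ[ℝ]) : leftMatrix p *ᵥ toVec q = toVec (p * q) := by
  ext i
  fin_cases i <;> simp [leftMatrix, toVec, mulVec, dotProduct, Fin.sum_univ_four] <;> ring

theorem rightMatrix_mulVec (p q : ℍ[ℝ]) : rightMatrix p *ᵥ toVec q = toVec (q * p) := by
  ext i
  fin_cases i <;> simp [rightMatrix, toVec, mulVec, dotProduct, Fin.sum_univ_four] <;> ring

theorem matrix_ext_toVec {A B : Matrix (Fin 4) (Fin 4) ℝ}
    (h : ∀ q, A *ᵥ toVec q = B *ᵥ toVec q) : A = B :=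
  Matrix.ext_of_mulVec_single fun i ↦ by
    obtain ⟨q, hq⟩ := toVec_surjective (Pi.single i 1)
    rw [← hq, h]

theorem leftMatrix_transpose (q : ℍ[ℝ]) : (leftMatrix q)ᵀ = leftMatrix (star q) := by
  ext i j
  fin_cases i <;> fin_cases j <;> simp [leftMatrix]

theorem rightMatrix_transpose (q : ℍ[ℝ]) : (rightMatrix q)ᵀ = rightMatrix (star q) := by
  ext i j
  fin_cases i <;> fin_cases j <;> simp [rightMatrix]

theorem det_leftMatrix (q : ℍ[ℝ]) : (leftMatrix q).det = normSq q ^ 2 := by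
  simp [leftMatrix, det_succ_row_zero, Fin.sum_univ_succ, normSq_def', Fin.succAbove]
  ring

theorem det_rightMatrix (q : ℍ[ℝ]) : (rightMatrix q).det = normSq q ^ 2 := by
  simp [rightMatrix, det_succ_row_zero, Fin.sum_univ_succ, normSq_def', Fin.succAbove]
  ring

/-- The pair of unit quaternions `(a, b)` acts on the space of quaternions by `x ↦ a x b⁻¹`. -/
noncomputable def rotationHom :
    Metric.sphere (0 : ℍ[ℝ]) 1 × Metric.sphere (0 : ℍ[ℝ]) 1 →* Matrix (Fin 4) (Fin 4) ℝ where
  toFun e := leftMatrix e.1 * rightMatrix (e.2 : ℍ[ℝ])⁻¹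
  map_one' := matrix_ext_toVec fun q ↦ by
    simp [← mulVec_mulVec, leftMatrix_mulVec, rightMatrix_mulVec]
  map_mul' e e' := matrix_ext_toVec fun q ↦ by
    simp [← mulVec_mulVec, leftMatrix_mulVec, rightMatrix_mulVec, mul_assoc]

theorem rotationHom_mulVec (e : Metric.sphere (0 : ℍ[ℝ]) 1 × Metric.sphere (0 : ℍ[ℝ]) 1)
    (q : ℍ[ℝ]) : rotationHom e *ᵥ toVec q = toVec (e.1 * q * (e.2 : ℍ[ℝ])⁻¹) := by
  simp [rotationHom, ← mulVec_mulVec, leftMatrix_mulVec, rightMatrix_mulVec, mul_assoc]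

theorem normSq_eq_one_of_mem_sphere (q : Metric.sphere (0 : ℍ[ℝ]) 1) : normSq (q : ℍ[ℝ]) = 1 := by
  simp [normSq_eq_norm_mul_self]

theorem continuous_rotationHom : Continuous rotationHom := by
  have h (q : Metric.sphere (0 : ℍ[ℝ]) 1) : (q : ℍ[ℝ])⁻¹ = star (q : ℍ[ℝ]) := by
    simp [Quaternion.inv_def, normSq_eq_one_of_mem_sphere]
  have := continuous_re
  have := continuous_imI
  have := continuous_imJ
  have := continuous_imK
  have hL : Continuous leftMatrix := by
    refine continuous_matrix fun i j ↦ ?_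
    fin_cases i <;> fin_cases j <;> simp [leftMatrix] <;> fun_prop
  have hR : Continuous rightMatrix := by
    refine continuous_matrix fun i j ↦ ?_
    fin_cases i <;> fin_cases j <;> simp [rightMatrix] <;> fun_prop
  simp only [rotationHom, h, MonoidHom.coe_mk, OneHom.coe_mk]
  fun_prop

theorem rotationHom_mem (e : Metric.sphere (0 : ℍ[ℝ]) 1 × Metric.sphere (0 : ℍ[ℝ]) 1) :
    (rotationHom e)ᵀ * rotationHom e = 1 ∧ (rotationHom e).det = 1 := by
  have h : (e.2 : ℍ[ℝ])⁻¹ = star (e.2 : ℍ[ℝ]) := by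
    simp [Quaternion.inv_def, normSq_eq_one_of_mem_sphere]
  have h1 := star_mul_self (e.1 : ℍ[ℝ])
  have h2 := star_mul_self (e.2 : ℍ[ℝ])
  simp only [normSq_eq_one_of_mem_sphere, coe_one] at h1 h2
  simp only [rotationHom, h, MonoidHom.coe_mk, OneHom.coe_mk]
  constructor
  · refine matrix_ext_toVec fun q ↦ ?_
    simp only [transpose_mul, leftMatrix_transpose, rightMatrix_transpose, ← mulVec_mulVec,
      leftMatrix_mulVec, rightMatrix_mulVec, star_star, one_mulVec]
    rw [← mul_assoc, h1, one_mul, mul_assoc, h2, mul_one]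
  · simp [det_leftMatrix, det_rightMatrix, normSq_eq_one_of_mem_sphere]

theorem ker_rotationHom_subset :
    (rotationHom.ker : Set (Metric.sphere (0 : ℍ[ℝ]) 1 × Metric.sphere (0 : ℍ[ℝ]) 1)) ⊆
      {1, (-1, -1)} := by
  rintro ⟨a, b⟩ (h : rotationHom (a, b) = 1)
  have hb : (b : ℍ[ℝ]) ≠ 0 := ne_zero_of_mem_unit_sphere b
  have hcomm (q : ℍ[ℝ]) : (a : ℍ[ℝ]) * q = q * b := by
    have := rotationHom_mulVec (a, b) q
    rw [h, one_mulVec] at this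
    exact (eq_mul_inv_iff_mul_eq₀ hb).1 (toVec_injective this) |>.symm
  have hab : a = b := Subtype.ext (by simpa using hcomm 1)
  subst hab
  have hi := hcomm unitI
  have hj := hcomm unitJ
  simp [Quaternion.ext_iff] at hi hj
  have hn := normSq_eq_one_of_mem_sphere a
  rw [normSq_def'] at hn
  have h1 : (a : ℍ[ℝ]).imI = 0 := by linarith
  have h2 : (a : ℍ[ℝ]).imJ = 0 := by linarith
  have h3 : (a : ℍ[ℝ]).imK = 0 := by linarith
  have h0 : (a : ℍ[ℝ]).re = 1 ∨ (a : ℍ[ℝ]).re = -1 := by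
    rw [← sq_eq_one_iff]; simpa [h1, h2, h3] using hn
  rcases h0 with h0 | h0
  · have : a = 1 := Subtype.ext (Quaternion.ext _ _ (by simpa) (by simpa) (by simpa) (by simpa))
    left; simp [this]
  · have : a = -1 := Subtype.ext (Quaternion.ext _ _ (by simpa) (by simpa) (by simpa) (by simpa))
    right; simp [this]

/-- Two unit imaginary quaternions are conjugate by a unit quaternion, which can be chosen to
commute with given elements. -/
theorem exists_unit_mul_eq_mul {u v r : ℍ[ℝ]} (hu : u * u = -1) (hv : v * v = -1) (hr : r ≠ 0)
    (hrv : r * v = -(v * r)) : ∃ q : Metric.sphere (0 : ℍ[ℝ]) 1, q * u = v * q ∧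
      ∀ z, Commute z (v * u) → Commute z r → Commute z (q : ℍ[ℝ]) := by
  obtain ⟨q, hq, hqu, hz⟩ : ∃ q : ℍ[ℝ], q ≠ 0 ∧ q * u = v * q ∧
      ∀ z, Commute z (v * u) → Commute z r → Commute z q := by
    by_cases huv : u = -v
    · exact ⟨r, hr, by rw [huv, mul_neg, hrv, neg_neg], fun z _ h ↦ h⟩
    · refine ⟨1 - v * u, fun h ↦ huv ?_, ?_, fun z h _ ↦ (Commute.one_right z).sub_right h⟩
      · have h' : v * (v * u) = v := by rw [← sub_eq_zero.1 h, mul_one]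
        rw [← h', ← mul_assoc, hv, neg_one_mul, neg_neg]
      · rw [sub_mul, mul_sub, mul_assoc, hu, ← mul_assoc, hv]
        simp [add_comm]
  refine ⟨⟨‖q‖⁻¹ • q, by simp [norm_smul, hq]⟩, ?_, fun z h h' ↦ (hz z h h').smul_right _⟩
  simp [hqu]

theorem mul_self_of_re_eq_zero {u : ℍ[ℝ]} (h : u.re = 0) (h' : normSq u = 1) : u * u = -1 := by
  rw [normSq_def', h] at h'
  ext <;> simp [h] <;> linarith

theorem dotProduct_of_mulVec_eq {A : Matrix (Fin 4) (Fin 4) ℝ} (hA : Aᵀ * A = 1) {p p' q q' : ℍ[ℝ]}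
    (hp : A *ᵥ toVec p = toVec p') (hq : A *ᵥ toVec q = toVec q') :
    toVec p' ⬝ᵥ toVec q' = toVec p ⬝ᵥ toVec q := by
  rw [← hp, ← hq, dotProduct_mulVec, ← mulVec_transpose, mulVec_mulVec, hA, one_mulVec]

theorem rotationHom_mul_mem {A : Matrix (Fin 4) (Fin 4) ℝ} (hA : Aᵀ * A = 1 ∧ A.det = 1)
    (e : Metric.sphere (0 : ℍ[ℝ]) 1 × Metric.sphere (0 : ℍ[ℝ]) 1) :
    (rotationHom e * A)ᵀ * (rotationHom e * A) = 1 ∧ (rotationHom e * A).det = 1 := by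
  obtain ⟨h1, h2⟩ := rotationHom_mem e
  refine ⟨?_, by rw [det_mul, h2, hA.2, one_mul]⟩
  rw [transpose_mul, Matrix.mul_assoc, ← Matrix.mul_assoc _ _ A, h1, Matrix.one_mul, hA.1]

theorem exists_rotationHom_mul_fixes_one {A : Matrix (Fin 4) (Fin 4) ℝ} (hA : Aᵀ * A = 1) :
    ∃ e, (rotationHom e * A) *ᵥ toVec 1 = toVec 1 := by
  obtain ⟨a, ha⟩ := toVec_surjective (A *ᵥ toVec 1)
  have h := dotProduct_of_mulVec_eq hA ha.symm ha.symm
  simp only [toVec_dotProduct_self, map_one] at h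
  have ha' : ‖a‖ = 1 := by
    rw [normSq_eq_norm_mul_self] at h
    exact (mul_self_eq_one_iff.1 h).resolve_right fun h' ↦ by linarith [norm_nonneg a]
  refine ⟨(⟨a, by simpa⟩⁻¹, 1), ?_⟩
  rw [← mulVec_mulVec, ← ha, rotationHom_mulVec]
  simp [norm_ne_zero_iff.1 (ha'.trans_ne one_ne_zero)]

theorem exists_rotationHom_mul_fixes_unitI {A : Matrix (Fin 4) (Fin 4) ℝ} (hA : Aᵀ * A = 1)
    (h1 : A *ᵥ toVec 1 = toVec 1) :
    ∃ e, (rotationHom e * A) *ᵥ toVec 1 = toVec 1 ∧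
      (rotationHom e * A) *ᵥ toVec unitI = toVec unitI := by
  obtain ⟨u, hu⟩ := toVec_surjective (A *ᵥ toVec unitI)
  have hu1 := dotProduct_of_mulVec_eq hA hu.symm h1
  have huu := dotProduct_of_mulVec_eq hA hu.symm hu.symm
  simp [toVec_dotProduct] at hu1
  simp only [toVec_dotProduct_self] at huu
  obtain ⟨q, hq, -⟩ := exists_unit_mul_eq_mul (u := u) (v := unitI) (r := unitJ)
    (mul_self_of_re_eq_zero hu1 (huu.trans (by simp [normSq_def'])))
    (mul_self_of_re_eq_zero rfl (by simp [normSq_def'])) (fun h ↦ by simpa using congrArg (·.imJ) h)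
    (by ext <;> simp)
  have hq0 : (q : ℍ[ℝ]) ≠ 0 := ne_zero_of_mem_unit_sphere q
  refine ⟨(q, q), ?_, ?_⟩
  · simp [← mulVec_mulVec, h1, rotationHom_mulVec, hq0]
  · simp [← mulVec_mulVec, ← hu, rotationHom_mulVec, hq, hq0]

theorem exists_rotationHom_mul_fixes_unitJ {A : Matrix (Fin 4) (Fin 4) ℝ} (hA : Aᵀ * A = 1)
    (h1 : A *ᵥ toVec 1 = toVec 1) (hI : A *ᵥ toVec unitI = toVec unitI) :
    ∃ e, (rotationHom e * A) *ᵥ toVec 1 = toVec 1 ∧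
      (rotationHom e * A) *ᵥ toVec unitI = toVec unitI ∧
      (rotationHom e * A) *ᵥ toVec unitJ = toVec unitJ := by
  obtain ⟨u, hu⟩ := toVec_surjective (A *ᵥ toVec unitJ)
  have hu1 := dotProduct_of_mulVec_eq hA hu.symm h1
  have huI := dotProduct_of_mulVec_eq hA hu.symm hI
  have huu := dotProduct_of_mulVec_eq hA hu.symm hu.symm
  simp [toVec_dotProduct] at hu1 huI
  simp only [toVec_dotProduct_self] at huu
  obtain ⟨q, hq, hq'⟩ := exists_unit_mul_eq_mul (u := u) (v := unitJ) (r := unitI)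
    (mul_self_of_re_eq_zero hu1 (huu.trans (by simp [normSq_def'])))
    (mul_self_of_re_eq_zero rfl (by simp [normSq_def'])) (fun h ↦ by simpa using congrArg (·.imI) h)
    (by ext <;> simp)
  have hqI : unitI * q = q * unitI :=
    hq' unitI (by ext <;> simp [hu1, huI]) (Commute.refl _)
  have hq0 : (q : ℍ[ℝ]) ≠ 0 := ne_zero_of_mem_unit_sphere q
  refine ⟨(q, q), ?_, ?_, ?_⟩
  · simp [← mulVec_mulVec, h1, rotationHom_mulVec, hq0]
  · simp [← mulVec_mulVec, hI, rotationHom_mulVec, ← hqI, hq0]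
  · simp [← mulVec_mulVec, ← hu, rotationHom_mulVec, hq, hq0]

theorem eq_one_of_mulVec_toVec_eq {A : Matrix (Fin 4) (Fin 4) ℝ} (hA : Aᵀ * A = 1 ∧ A.det = 1)
    (h1 : A *ᵥ toVec 1 = toVec 1) (hI : A *ᵥ toVec unitI = toVec unitI)
    (hJ : A *ᵥ toVec unitJ = toVec unitJ) : A = 1 := by
  obtain ⟨u, hu⟩ := toVec_surjective (A *ᵥ toVec unitK)
  have hu1 := dotProduct_of_mulVec_eq hA.1 hu.symm h1
  have huI := dotProduct_of_mulVec_eq hA.1 hu.symm hI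
  have huJ := dotProduct_of_mulVec_eq hA.1 hu.symm hJ
  simp [toVec_dotProduct] at hu1 huI huJ
  have key : A = diagonal ![1, 1, 1, u.imK] := by
    refine Matrix.ext_of_mulVec_single fun i ↦ ?_
    have e0 : Pi.single 0 1 = toVec 1 := by ext i; fin_cases i <;> simp [toVec]
    have e1 : Pi.single 1 1 = toVec unitI := by ext i; fin_cases i <;> simp [toVec]
    have e2 : Pi.single 2 1 = toVec unitJ := by ext i; fin_cases i <;> simp [toVec]
    have e3 : Pi.single 3 1 = toVec unitK := by ext i; fin_cases i <;> simp [toVec]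
    fin_cases i
    · simp only [Fin.zero_eta, e0, h1]
      ext j; fin_cases j <;> simp [toVec, mulVec_diagonal]
    · simp only [Fin.mk_one, e1, hI]
      ext j; fin_cases j <;> simp [toVec, mulVec_diagonal]
    · simp only [Fin.reduceFinMk, e2, hJ]
      ext j; fin_cases j <;> simp [toVec, mulVec_diagonal]
    · simp only [Fin.reduceFinMk, e3, ← hu]
      ext j; fin_cases j <;> simp [toVec, mulVec_diagonal, hu1, huI, huJ]
  have hdet := hA.2
  rw [key, det_diagonal] at hdet
  simp [Fin.prod_univ_four] at hdet
  rw [key, hdet]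
  ext i j
  fin_cases i <;> fin_cases j <;> simp

theorem exists_rotationHom_eq {A : Matrix (Fin 4) (Fin 4) ℝ} (hA : Aᵀ * A = 1 ∧ A.det = 1) :
    ∃ e, rotationHom e = A := by
  obtain ⟨e, h1⟩ := exists_rotationHom_mul_fixes_one hA.1
  have he := rotationHom_mul_mem hA e
  obtain ⟨e', h1', hI'⟩ := exists_rotationHom_mul_fixes_unitI he.1 h1
  have he' := rotationHom_mul_mem he e'
  obtain ⟨e'', h1'', hI'', hJ''⟩ := exists_rotationHom_mul_fixes_unitJ he'.1 h1' hI'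
  have h := eq_one_of_mulVec_toVec_eq (rotationHom_mul_mem he' e'') h1'' hI'' hJ''
  refine ⟨(e'' * e' * e)⁻¹, ?_⟩
  rw [← Matrix.mul_one (rotationHom _), ← h, ← Matrix.mul_assoc, ← Matrix.mul_assoc,
    ← Matrix.mul_assoc, ← map_mul, ← map_mul, ← map_mul]
  simp [mul_assoc]

theorem isCoveringMap_rotationHom :
    IsCoveringMap fun e : Metric.sphere (0 : ℍ[ℝ]) 1 × Metric.sphere (0 : ℍ[ℝ]) 1 ↦
      (⟨rotationHom e, rotationHom_mem e⟩ : SO4) := by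
  have : ProperSpace ℍ[ℝ] := FiniteDimensional.proper ℝ ℍ[ℝ]
  have hker : IsDiscrete (rotationHom.ker :
      Set (Metric.sphere (0 : ℍ[ℝ]) 1 × Metric.sphere (0 : ℍ[ℝ]) 1)) :=
    ((Set.toFinite _).subset ker_rotationHom_subset).isDiscrete
  have hc : Continuous fun e : Metric.sphere (0 : ℍ[ℝ]) 1 × Metric.sphere (0 : ℍ[ℝ]) 1 ↦
      (⟨rotationHom e, rotationHom_mem e⟩ : SO4) := continuous_rotationHom.subtype_mk _
  have hs : Function.Surjective fun e : Metric.sphere (0 : ℍ[ℝ]) 1 × Metric.sphere (0 : ℍ[ℝ]) 1 ↦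
      (⟨rotationHom e, rotationHom_mem e⟩ : SO4) := fun A ↦
    (exists_rotationHom_eq A.2).imp fun e he ↦ Subtype.ext he
  have hq := hc.isClosedMap.isQuotientMap hc hs
  refine (hq.isQuotientCoveringMap_of_subgroup rotationHom.ker hker fun {e e'} ↦ ?_).isCoveringMap
  rw [Subtype.ext_iff, MonoidHom.mem_ker]
  constructor
  · intro (h : rotationHom e = rotationHom e')
    rw [map_mul, ← h, ← map_mul, mul_inv_cancel, map_one]
  · intro h
    change rotationHom e = rotationHom e'
    rw [← inv_mul_cancel_right e' e, map_mul, h, Matrix.one_mul]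

end Quaternion

/-- the second homotopy group of `SO(4)` is trivial: `π₂(SO(4), 1) ≅ 0`. -/
theorem pi2_so4_trivial : Subsingleton (π_ 2 SO4 so4One) := by
  have (b : Metric.sphere (0 : ℍ[ℝ]) 1) :
      Subsingleton (HomotopyGroup (Fin 2) (Metric.sphere (0 : ℍ[ℝ]) 1) b) :=
    HomotopyGroup.subsingleton_sphere (by simp [Quaternion.finrank_eq_four]) b
  have := HomotopyGroup.subsingleton_prod (N := Fin 2) (1 : Metric.sphere (0 : ℍ[ℝ]) 1)
    (1 : Metric.sphere (0 : ℍ[ℝ]) 1)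
  exact Quaternion.isCoveringMap_rotationHom.subsingleton_homotopyGroup (N := Fin 2)
    (Subtype.ext (map_one Quaternion.rotationHom))
end
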